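/- Fix integers u, s ≥ 1 and m ≥ 1, and reals K > 0 and ρ ∈ (0,1). There exists M* > 0, depending only on u, s, m, K, ρ, with the following property. Let U ⊆ ℝ^u × ℝ^s be a convex bounded neighborhood of 0 and f : U → ℝ^u × ℝ^s a C^{m+1} map with f(0) = 0 all of whose derivatives of order ≤ m+1 are bounded in norm by some c ≤ K on U, and suppose the y-component of f has vanishing pure-x derivatives at 0 up to order m: for 1 ≤ j ≤ m, D^j(π_y ∘ f)(0)(h₁,…,h_j) = 0 whenever h₁,…,h_j ∈ ℝ^u × {0}. Suppose there are ξ > 0, B ≥ 0, μ ≥ 0 with 1/ξ ≤ K, B ≤ K and μ/ξ^{m+1} < ρ such that m(∂f_x/∂x(0)) ≥ ξ, ‖∂f_x/∂y(0)‖ ≤ B, and ‖∂f_y/∂y(0)‖ ≤ μ. Then for every M > M* there exists δ > 0 such that for all (x,y) ∈ U with ‖(x,y)‖ ≤ δ and ‖y‖ ≤ M‖x‖^{m+1}, one has ‖π_y f(x,y)‖ ≤ M‖π_x f(x,y)‖^{m+1}. -/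

import Mathlib

noncomputable section

open Metric Set

/-- `ℝ^n` with the Euclidean norm. -/
abbrev Evec (n : ℕ) : Type := EuclideanSpace ℝ (Fin n)

/-- `ℝ^u × ℝ^s` with the Euclidean (ℓ²) product norm. -/
abbrev EF (u s : ℕ) : Type := WithLp 2 (Evec u × Evec s)

/-- Projection `π_x` onto the first factor. -/
def projX (u s : ℕ) : EF u s →L[ℝ] Evec u :=
  (ContinuousLinearMap.fst ℝ (Evec u) (Evec s)).comp
    (WithLp.prodContinuousLinearEquiv 2 ℝ (Evec u) (Evec s)).toContinuousLinearMap

/-- Projection `π_y` onto the second factor. -/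
def projY (u s : ℕ) : EF u s →L[ℝ] Evec s :=
  (ContinuousLinearMap.snd ℝ (Evec u) (Evec s)).comp
    (WithLp.prodContinuousLinearEquiv 2 ℝ (Evec u) (Evec s)).toContinuousLinearMap

/-- Inclusion `v ↦ (v, 0)` of the first factor. -/
def inX (u s : ℕ) : Evec u →L[ℝ] EF u s :=
  ((WithLp.prodContinuousLinearEquiv 2 ℝ (Evec u) (Evec s)).symm.toContinuousLinearMap).comp
    (ContinuousLinearMap.inl ℝ (Evec u) (Evec s))

/-- Inclusion `w ↦ (0, w)` of the second factor. -/
def inY (u s : ℕ) : Evec s →L[ℝ] EF u s :=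
  ((WithLp.prodContinuousLinearEquiv 2 ℝ (Evec u) (Evec s)).symm.toContinuousLinearMap).comp
    (ContinuousLinearMap.inr ℝ (Evec u) (Evec s))

/-- `m(A)`: the largest `t ≥ 0` such that `‖A v‖ ≥ t * ‖v‖` for all `v`. -/
def minNorm {E F : Type*} [NormedAddCommGroup E] [NormedSpace ℝ E]
    [NormedAddCommGroup F] [NormedSpace ℝ F] (A : E →L[ℝ] F) : ℝ :=
  sSup {t : ℝ | 0 ≤ t ∧ ∀ v, t * ‖v‖ ≤ ‖A v‖}


open Filter Topology

theorem aux_taylor {E F : Type*} [NormedAddCommGroup E] [NormedSpace ℝ E]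
    [NormedAddCommGroup F] [NormedSpace ℝ F] (m : ℕ) (g : E → F) (r C : ℝ)
    (hg : ContDiffOn ℝ (m + 1) g (ball 0 r)) (hg0 : g 0 = 0)
    (hC : ∀ z ∈ ball (0 : E) r, ‖iteratedFDeriv ℝ (m + 1) g z‖ ≤ C) (v : E)
    (hv : v ∈ ball (0 : E) r)
    (h0 : ∀ j : ℕ, 1 ≤ j → j ≤ m → iteratedFDeriv ℝ j g 0 (fun _ => v) = 0) :
    ‖g v‖ ≤ C * ‖v‖ ^ (m + 1) := by
  set L : ℝ →L[ℝ] E := ContinuousLinearMap.toSpanSingleton ℝ v with hL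
  have hLt : ∀ t, L t = t • v := fun t => by simp [hL]
  have hopen : IsOpen (L ⁻¹' ball (0 : E) r) := isOpen_ball.preimage L.continuous
  have hmem : ∀ t ∈ Icc (0 : ℝ) 1, L t ∈ ball (0 : E) r := by
    intro t ht
    rw [mem_ball_zero_iff] at hv ⊢
    rw [hLt, norm_smul, Real.norm_eq_abs, abs_of_nonneg ht.1]
    nlinarith [norm_nonneg v, ht.2]
  have hcd : ContDiffOn ℝ (m + 1) (g ∘ L) (L ⁻¹' ball (0 : E) r) :=
    hg.comp_continuousLinearMap L
  have key : ∀ k : ℕ, k ≤ m + 1 → ∀ t ∈ Icc (0 : ℝ) 1,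
      iteratedDerivWithin k (g ∘ L) (Icc 0 1) t = iteratedFDeriv ℝ k g (L t) (fun _ => v) := by
    intro k hk t ht
    have hk' : (k : WithTop ℕ∞) ≤ (m : WithTop ℕ∞) + 1 := by exact_mod_cast hk
    have hca : ContDiffAt ℝ k (g ∘ L) t :=
      (hcd.contDiffAt (hopen.mem_nhds (hmem t ht))).of_le hk'
    rw [iteratedDerivWithin_eq_iteratedDeriv (uniqueDiffOn_Icc one_pos) hca ht,
      iteratedDeriv_eq_iteratedFDeriv,
      ← iteratedFDerivWithin_of_isOpen k hopen (hmem t ht),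
      L.iteratedFDerivWithin_comp_right hg isOpen_ball.uniqueDiffOn hopen.uniqueDiffOn
        (hmem t ht) hk', iteratedFDerivWithin_of_isOpen k isOpen_ball (hmem t ht)]
    simp [hLt]
  have hT := taylor_mean_remainder_bound (f := g ∘ L) (a := 0) (b := 1) (x := 1) (n := m)
    (C := C * ‖v‖ ^ (m + 1)) zero_le_one (hcd.mono hmem) (by simp) (by
      intro t ht
      rw [key _ le_rfl t ht]
      refine ((iteratedFDeriv ℝ (m + 1) g (L t)).le_opNorm _).trans ?_
      simp only [Finset.prod_const, Finset.card_univ, Fintype.card_fin]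
      gcongr
      exact hC _ (hmem t ht))
  have hz : taylorWithinEval (g ∘ L) m (Icc 0 1) 0 1 = 0 := by
    rw [taylor_within_apply]
    refine Finset.sum_eq_zero fun k hk => ?_
    have hk' : k < m + 1 := Finset.mem_range.1 hk
    rw [key k hk'.le 0 (by simp)]
    rcases Nat.eq_zero_or_pos k with rfl | hpos
    · simp [hLt, hg0]
    · have : L 0 = 0 := by simp
      rw [this, h0 k hpos (by omega), smul_zero]
  rw [hz] at hT
  have hCn : 0 ≤ C := (norm_nonneg _).trans (hC v hv)
  have h1 : (1 : ℝ) ≤ (m.factorial : ℝ) := by exact_mod_cast Nat.succ_le_of_lt m.factorial_pos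
  have h2 : C * ‖v‖ ^ (m + 1) * (1 - 0) ^ (m + 1) / (m.factorial : ℝ) ≤ C * ‖v‖ ^ (m + 1) := by
    simp only [sub_zero, one_pow, mul_one]
    exact div_le_self (by positivity) h1
  have h3 : (g ∘ L) 1 - 0 = g v := by simp [hLt]
  rw [h3] at hT
  exact hT.trans h2

theorem aux_minNorm {E F : Type*} [NormedAddCommGroup E] [NormedSpace ℝ E]
    [NormedAddCommGroup F] [NormedSpace ℝ F] (A : E →L[ℝ] F) (ξ : ℝ)
    (h : ξ ≤ minNorm A) (v : E) : ξ * ‖v‖ ≤ ‖A v‖ := by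
  refine le_of_forall_lt_imp_le_of_dense fun a ha => ?_
  rcases (norm_nonneg v).eq_or_lt with h0 | h0
  · rw [← h0, mul_zero] at ha
    exact ha.le.trans (norm_nonneg _)
  · have h1 : a / ‖v‖ < minNorm A := ((div_lt_iff₀ h0).2 ha).trans_le h
    have hne : {t : ℝ | 0 ≤ t ∧ ∀ v, t * ‖v‖ ≤ ‖A v‖}.Nonempty := ⟨0, le_rfl, by simp⟩
    obtain ⟨t, ht, h2⟩ := exists_lt_of_lt_csSup hne h1
    have := ht.2 v
    have := (div_lt_iff₀ h0).1 h2
    linarith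

theorem aux_projX_le (u s : ℕ) (z : EF u s) : ‖projX u s z‖ ≤ ‖z‖ :=
  WithLp.norm_fst_le _ z

theorem aux_projY_le (u s : ℕ) (z : EF u s) : ‖projY u s z‖ ≤ ‖z‖ :=
  WithLp.norm_snd_le _ z

theorem aux_inX (u s : ℕ) (x : Evec u) : ‖inX u s x‖ = ‖x‖ :=
  WithLp.norm_toLp_fst 2 (Evec u) (Evec s) x

theorem aux_inY (u s : ℕ) (x : Evec s) : ‖inY u s x‖ = ‖x‖ :=
  WithLp.norm_toLp_snd 2 (Evec u) (Evec s) x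

theorem aux_decomp (u s : ℕ) (z : EF u s) :
    z = inX u s (projX u s z) + inY u s (projY u s z) := by
  apply (WithLp.equiv 2 _).injective
  ext <;> simp [inX, inY, projX, projY]

theorem aux_eps (m : ℕ) (K μ ξ M : ℝ) (hξ : 0 < ξ) (h : μ * M + K < M * ξ ^ (m + 1)) :
    ∃ ε : ℝ, 0 < ε ∧ ε ≤ 1 ∧ 0 ≤ ξ - (K + 2) * ε ∧
      (μ + ε) * M + K ≤ M * (ξ - (K + 2) * ε) ^ (m + 1) := by
  have c1 : ContinuousAt (fun ε : ℝ => ξ - (K + 2) * ε) 0 := by fun_prop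
  have c2 : ContinuousAt (fun ε : ℝ => (μ + ε) * M + K) 0 := by fun_prop
  have c3 : ContinuousAt (fun ε : ℝ => M * (ξ - (K + 2) * ε) ^ (m + 1)) 0 := by fun_prop
  have e1 : ∀ᶠ ε in 𝓝 (0 : ℝ), 0 < ξ - (K + 2) * ε :=
    c1.eventually (lt_mem_nhds (by simpa using hξ))
  have e2 := c2.eventually_lt c3 (by simpa using h)
  have e3 : ∀ᶠ ε in 𝓝 (0 : ℝ), ε < 1 := gt_mem_nhds one_pos
  have e4 : ∀ᶠ ε in 𝓝[>] (0 : ℝ), 0 < ε := self_mem_nhdsWithin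
  obtain ⟨ε, h4, h1, h2, h3⟩ :=
    (e4.and ((e1.and (e2.and e3)).filter_mono nhdsWithin_le_nhds)).exists
  exact ⟨ε, h4, h3.le, h1.le, h2.le⟩

/-- Lemma B.1 (unstable jets in a good frame): there is `M* = M*(u,s,m,K,ρ)` such
that for any `C^{m+1}` map `f` fixing `0` on a convex bounded neighborhood `U` of
`0` with all derivatives of order `≤ m+1` bounded by `c ≤ K`, whose `y`-component
has vanishing pure-`x` derivatives at `0` up to order `m`, and rate constants
`ξ, B, μ` with `1/ξ ≤ K`, `B ≤ K`, `μ/ξ^{m+1} < ρ`, for every `M > M*` there is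
`δ > 0` such that `f` maps `{‖y‖ ≤ M‖x‖^{m+1}} ∩ B̄(0,δ) ∩ U` into
`{‖y‖ ≤ M‖x‖^{m+1}}`. -/
theorem stmt3 (u s : ℕ) (hu : 0 < u) (hs : 0 < s) (m : ℕ) (hm : 1 ≤ m)
    (K ρ : ℝ) (hK : 0 < K) (hρ0 : 0 < ρ) (hρ1 : ρ < 1) :
    ∃ Mstar : ℝ, 0 < Mstar ∧
      ∀ (U : Set (EF u s)), Convex ℝ U → Bornology.IsBounded U → U ∈ nhds (0 : EF u s) →
      ∀ f : EF u s → EF u s, ContDiffOn ℝ (m + 1) f U → f 0 = 0 →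
      ∀ c : ℝ, c ≤ K →
      (∀ z ∈ U, ∀ k ≤ m + 1, ‖iteratedFDerivWithin ℝ k f U z‖ ≤ c) →
      (∀ j : ℕ, 1 ≤ j → j ≤ m → ∀ h : Fin j → Evec u,
        iteratedFDeriv ℝ j (fun z => projY u s (f z)) 0 (fun i => inX u s (h i)) = 0) →
      ∀ ξ B μ : ℝ, 0 < ξ → 1 / ξ ≤ K → 0 ≤ B → B ≤ K → 0 ≤ μ → μ / ξ ^ (m + 1) < ρ →
        ξ ≤ minNorm ((projX u s).comp ((fderiv ℝ f 0).comp (inX u s))) →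
        ‖(projX u s).comp ((fderiv ℝ f 0).comp (inY u s))‖ ≤ B →
        ‖(projY u s).comp ((fderiv ℝ f 0).comp (inY u s))‖ ≤ μ →
      ∀ M : ℝ, Mstar < M →
        ∃ δ : ℝ, 0 < δ ∧ ∀ z ∈ U, ‖z‖ ≤ δ →
          ‖projY u s z‖ ≤ M * ‖projX u s z‖ ^ (m + 1) →
          ‖projY u s (f z)‖ ≤ M * ‖projX u s (f z)‖ ^ (m + 1) := by
  refine ⟨K ^ (m + 2) / (1 - ρ), by have : 0 < 1 - ρ := by linarith
                                    positivity, ?_⟩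
  intro U hUc _ hU f hf hf0 c hc hder hvan ξ B μ hξ hξK hB hBK hμ hμξ hxx hxy hyy M hM
  have hρ' : 0 < 1 - ρ := by linarith
  have hM0 : 0 < M := lt_trans (by positivity) hM
  have hξp : 0 < ξ ^ (m + 1) := by positivity
  have hstrict : μ * M + K < M * ξ ^ (m + 1) := by
    have h1 : μ < ρ * ξ ^ (m + 1) := (div_lt_iff₀ hξp).1 hμξ
    have h2 : K ^ (m + 2) < M * (1 - ρ) := (div_lt_iff₀ hρ').1 hM
    have h3 : 1 ≤ K * ξ := (div_le_iff₀ hξ).1 hξK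
    have h4 : 1 ≤ (K * ξ) ^ (m + 1) := one_le_pow₀ h3
    have h5 : K ≤ K ^ (m + 2) * ξ ^ (m + 1) := by
      calc K = K * 1 := (mul_one K).symm
        _ ≤ K * (K * ξ) ^ (m + 1) := by gcongr
        _ = K ^ (m + 2) * ξ ^ (m + 1) := by rw [mul_pow]; ring
    have h6 := mul_lt_mul_of_pos_right h2 hξp
    have h7 := mul_lt_mul_of_pos_right h1 hM0
    nlinarith
  obtain ⟨ε, hε, hε1, hε2, hε3⟩ := aux_eps m K μ ξ M hξ hstrict
  obtain ⟨r, hr, hrU⟩ := Metric.mem_nhds_iff.1 hU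
  have hfa : ContDiffAt ℝ (m + 1) f 0 := hf.contDiffAt hU
  have hsd := hfa.hasStrictFDerivAt (by simp)
  obtain ⟨S, hS, hap⟩ := hsd.approximates_deriv_on_nhds (c := ⟨ε, hε.le⟩) (Or.inr hε)
  obtain ⟨r', hr', hrS⟩ := Metric.mem_nhds_iff.1 hS
  set D := fderiv ℝ f 0 with hD
  have hap' : ∀ z w : EF u s, ‖z‖ < r' → ‖w‖ < r' →
      ‖f z - f w - D (z - w)‖ ≤ ε * ‖z - w‖ := fun z w hz hw =>
    hap z (hrS (by simpa using hz)) w (hrS (by simpa using hw))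
  have hYn : ‖projY u s‖ ≤ 1 :=
    ContinuousLinearMap.opNorm_le_bound _ zero_le_one (by simpa using aux_projY_le u s)
  have htay : ∀ x : Evec u, ‖x‖ < r → ‖projY u s (f (inX u s x))‖ ≤ K * ‖x‖ ^ (m + 1) := by
    intro x hx
    have hfb := hf.mono hrU
    have := aux_taylor m (fun z => projY u s (f z)) r K
      (hfb.continuousLinearMap_comp (projY u s)) (by simp [hf0]) (by
        intro z hz
        have hzU : U ∈ 𝓝 z := mem_of_superset (isOpen_ball.mem_nhds hz) hrU
        have hcz : ContDiffAt ℝ (m + 1) f z := hf.contDiffAt hzU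
        have h1 := (projY u s).norm_iteratedFDeriv_comp_left (n := m + 1) hcz
          (by exact_mod_cast le_rfl)
        have h2 : iteratedFDerivWithin ℝ (m + 1) f U z = iteratedFDeriv ℝ (m + 1) f z := by
          rw [← iteratedFDerivWithin_univ]
          exact iteratedFDerivWithin_congr_set (Filter.eventuallyEq_univ.mpr hzU) _
        have h3 := (hder z (hrU hz) (m + 1) le_rfl).trans hc
        rw [h2] at h3
        refine h1.trans ?_
        calc _ ≤ 1 * K := by gcongr
          _ = K := one_mul K)
      (inX u s x) (by simpa [aux_inX] using hx) (fun j h1 h2 => hvan j h1 h2 fun _ => x)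
    rwa [aux_inX] at this
  obtain ⟨δ, hδ0, hδ⟩ : ∃ δ : ℝ, 0 < δ ∧ (δ ≤ 1 ∧ M * δ ≤ ε ∧ δ < r ∧ δ < r') := by
    have c1 : ContinuousAt (fun δ : ℝ => M * δ) 0 := by fun_prop
    have e1 : ∀ᶠ δ in 𝓝 (0 : ℝ), M * δ < ε := c1.eventually (gt_mem_nhds (by simpa using hε))
    have e2 : ∀ᶠ δ in 𝓝 (0 : ℝ), δ < 1 := gt_mem_nhds one_pos
    have e3 : ∀ᶠ δ in 𝓝 (0 : ℝ), δ < r := gt_mem_nhds hr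
    have e4 : ∀ᶠ δ in 𝓝 (0 : ℝ), δ < r' := gt_mem_nhds hr'
    have e5 : ∀ᶠ δ in 𝓝[>] (0 : ℝ), 0 < δ := self_mem_nhdsWithin
    obtain ⟨δ, h5, h1, h2, h3, h4⟩ :=
      (e5.and ((e1.and (e2.and (e3.and e4))).filter_mono nhdsWithin_le_nhds)).exists
    exact ⟨δ, h5, h2.le, h1.le, h3, h4⟩
  obtain ⟨hδ1, hδM, hδr, hδr'⟩ := hδ
  refine ⟨δ, hδ0, fun z _ hzδ hcone => ?_⟩
  have hzdec := aux_decomp u s z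
  have hxz := aux_projX_le u s z
  set x := projX u s z with hx
  set y := projY u s z with hy
  have hxδ : ‖x‖ ≤ δ := hxz.trans hzδ
  have hyx : ‖y‖ ≤ ε * ‖x‖ := by
    have h1 : ‖x‖ ^ m ≤ δ := by
      calc ‖x‖ ^ m ≤ δ ^ m := by gcongr
        _ ≤ δ ^ 1 := pow_le_pow_of_le_one hδ0.le hδ1 hm
        _ = δ := pow_one δ
    calc ‖y‖ ≤ M * ‖x‖ ^ (m + 1) := hcone
      _ = M * ‖x‖ ^ m * ‖x‖ := by ring
      _ ≤ M * δ * ‖x‖ := by gcongr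
      _ ≤ ε * ‖x‖ := by gcongr
  have hw : ‖inX u s x‖ < r' := by rw [aux_inX]; linarith
  have hzw : z - inX u s x = inY u s y := by
    rw [sub_eq_iff_eq_add']; exact hzdec
  -- y component
  have hY : ‖projY u s (f z)‖ ≤ K * ‖x‖ ^ (m + 1) + (μ + ε) * ‖y‖ := by
    have h1 := hap' z (inX u s x) (by linarith) hw
    rw [hzw, aux_inY] at h1
    have h2 := (aux_projY_le u s _).trans h1
    have h3 : ‖projY u s (D (inY u s y))‖ ≤ μ * ‖y‖ :=
      (((projY u s).comp (D.comp (inY u s))).le_opNorm y).trans (by gcongr)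
    have h4 := htay x (by linarith)
    have h5 : projY u s (f z) = projY u s (f z - f (inX u s x) - D (inY u s y)) +
        projY u s (f (inX u s x)) + projY u s (D (inY u s y)) := by
      simp only [map_sub]; abel
    rw [h5]
    refine (norm_add₃_le).trans ?_
    linarith
  have hX : (ξ - (K + 2) * ε) * ‖x‖ ≤ ‖projX u s (f z)‖ := by
    have h1 := hap' z 0 (by linarith) (by simpa using hr')
    rw [hf0, sub_zero, sub_zero] at h1
    have h2 := (aux_projX_le u s _).trans h1
    have h3 : ‖projX u s (D (inY u s y))‖ ≤ B * ‖y‖ :=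
      (((projX u s).comp (D.comp (inY u s))).le_opNorm y).trans (by gcongr)
    have h4 : ξ * ‖x‖ ≤ ‖projX u s (D (inX u s x))‖ := aux_minNorm _ ξ hxx x
    have h5 : projX u s (D (inX u s x)) = projX u s (f z) - projX u s (f z - D z)
        - projX u s (D (inY u s y)) := by
      have : D z = D (inX u s x) + D (inY u s y) := by rw [← map_add, ← hzdec]
      rw [map_sub, this, map_add]; abel
    have h6 : ‖projX u s (D (inX u s x))‖ ≤ ‖projX u s (f z)‖ + ‖projX u s (f z - D z)‖
        + ‖projX u s (D (inY u s y))‖ := by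
      rw [h5]
      exact (norm_sub_le _ _).trans (by gcongr; exact norm_sub_le _ _)
    have h7 : ‖z‖ ≤ ‖x‖ + ‖y‖ := by
      calc ‖z‖ = ‖inX u s x + inY u s y‖ := by rw [← hzdec]
        _ ≤ _ := norm_add_le _ _
        _ = _ := by rw [aux_inX, aux_inY]
    have h8 : B * ‖y‖ ≤ K * (ε * ‖x‖) := by gcongr
    have h9 : ‖z‖ ≤ 2 * ‖x‖ := by
      have : ε * ‖x‖ ≤ 1 * ‖x‖ := by gcongr
      linarith
    have h10 : ε * ‖z‖ ≤ ε * (2 * ‖x‖) := by gcongr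
    linarith
  calc ‖projY u s (f z)‖ ≤ K * ‖x‖ ^ (m + 1) + (μ + ε) * ‖y‖ := hY
    _ ≤ K * ‖x‖ ^ (m + 1) + (μ + ε) * (M * ‖x‖ ^ (m + 1)) := by gcongr
    _ = ((μ + ε) * M + K) * ‖x‖ ^ (m + 1) := by ring
    _ ≤ (M * (ξ - (K + 2) * ε) ^ (m + 1)) * ‖x‖ ^ (m + 1) := by gcongr
    _ = M * ((ξ - (K + 2) * ε) * ‖x‖) ^ (m + 1) := by rw [mul_pow]; ring
    _ ≤ M * ‖projX u s (f z)‖ ^ (m + 1) := by gcongr
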